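/- Let R ∈ (-1,1), let p(x,y;R) be the standard bivariate Gaussian density with correlation R, and let h(x) = (1/2)·Σ_{l=1}^{L} w_l·(|x − α_l| + |x + α_l|) with weights w_l ≥ 0 satisfying Σ_l w_l = 1 and offsets α_l ≥ 0, and set f(x,y) = h(x+y) − h(x−y). Then ∫∫_{ℝ²} f(x,y)·p(x,y;R) dx dy = ∫_0^R Σ_{l=1}^{L} [ (w_l/√(π(1+ρ)))·exp(−α_l²/(4(1+ρ))) + (w_l/√(π(1−ρ)))·exp(−α_l²/(4(1−ρ))) ] dρ. -/

import Mathlib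

open MeasureTheory Real

/-- The standard bivariate Gaussian density with correlation `R`. -/
noncomputable def biGaussDensity (R x y : ℝ) : ℝ :=
  (1 / (2 * Real.pi * Real.sqrt (1 - R ^ 2))) *
    Real.exp (-(x ^ 2 + y ^ 2 - 2 * R * x * y) / (2 * (1 - R ^ 2)))

lemma aux_int (a c b : ℝ) (hb : 0 < b) :
    Integrable (fun s : ℝ => |c * s - a| * Real.exp (-b * s ^ 2)) := by
  have h1 := (integrable_mul_exp_neg_mul_sq hb).const_mul c
  have h2 := (integrable_exp_neg_mul_sq hb).const_mul a
  refine (h1.sub h2).abs.congr (Filter.Eventually.of_forall fun s => ?_)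
  simp only [Pi.sub_apply]
  rw [show c * (s * Real.exp (-b * s ^ 2)) - a * Real.exp (-b * s ^ 2)
    = (c * s - a) * Real.exp (-b * s ^ 2) by ring, abs_mul, abs_of_pos (Real.exp_pos _)]

lemma aux_tail (t : ℝ) :
    ∫ z in Set.Ioi t, z * Real.exp (-(1/2) * z ^ 2) = Real.exp (-(1/2) * t ^ 2) := by
  have hd : ∀ x ∈ Set.Ici t, HasDerivAt (fun z : ℝ => -Real.exp (-(1/2) * z ^ 2))
      (x * Real.exp (-(1/2) * x ^ 2)) x := by
    intro x _
    have := (((hasDerivAt_pow 2 x).const_mul (-(1/2) : ℝ)).exp).neg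
    refine this.congr_deriv ?_
    push_cast
    ring
  have hl : Filter.Tendsto (fun z : ℝ => -Real.exp (-(1/2) * z ^ 2)) Filter.atTop (nhds 0) := by
    rw [← neg_zero]
    refine (Real.tendsto_exp_atBot.comp ?_).neg
    exact (Filter.tendsto_pow_atTop (two_ne_zero)).const_mul_atTop_of_neg (by norm_num)
  have := integral_Ioi_of_hasDerivAt_of_tendsto' hd
    (integrable_mul_exp_neg_mul_sq (by norm_num)).integrableOn hl
  rw [this]; ring

lemma aux_full : ∫ z : ℝ, z * Real.exp (-(1/2) * z ^ 2) = 0 := by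
  have h := integral_neg_eq_self (fun z : ℝ => z * Real.exp (-(1/2) * z ^ 2)) volume
  simp only [neg_mul, even_two, Even.neg_pow, integral_neg] at h
  simp only [neg_mul]
  linarith

/-- one-dimensional functional -/
noncomputable def auxB (a σ : ℝ) : ℝ := ∫ z : ℝ, |σ * z - a| * Real.exp (-(1/2) * z ^ 2)

lemma auxB_deriv (a σ : ℝ) (hσ : 0 < σ) :
    HasDerivAt (auxB a) (2 * Real.exp (-(1/2) * (a / σ) ^ 2)) σ := by
  have hI := integrable_mul_exp_neg_mul_sq (b := 1/2) (by norm_num)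
  set F' : ℝ → ℝ := fun z => (Set.Ioi (a/σ)).indicator
      (fun z => 2 * (z * Real.exp (-(1/2) * z ^ 2))) z - z * Real.exp (-(1/2) * z ^ 2) with hF'
  have hint : Integrable ((Set.Ioi (a/σ)).indicator
      (fun z => 2 * (z * Real.exp (-(1/2) * z ^ 2)))) :=
    (hI.const_mul 2).indicator measurableSet_Ioi
  have hval : ∫ z, F' z = 2 * Real.exp (-(1/2) * (a / σ) ^ 2) := by
    rw [hF', integral_sub hint hI, aux_full, integral_indicator measurableSet_Ioi,
      integral_const_mul, aux_tail]
    ring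
  have key := hasDerivAt_integral_of_dominated_loc_of_lip (μ := volume)
    (F := fun σ z : ℝ => |σ * z - a| * Real.exp (-(1/2) * z ^ 2)) (x₀ := σ) (F' := F')
    (bound := fun z => |z * Real.exp (-(1/2) * z ^ 2)|) (s := Set.univ) Filter.univ_mem
    (Filter.Eventually.of_forall fun s => (aux_int a s (1/2) (by norm_num)).aestronglyMeasurable)
    (aux_int a σ (1/2) (by norm_num))
    (hint.sub hI).aestronglyMeasurable
    (Filter.Eventually.of_forall fun z => ?_) hI.abs ?_
  · rw [← hval]; exact key.2
  · refine LipschitzOnWith.of_dist_le_mul fun x _ y _ => ?_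
    rw [Real.dist_eq, Real.dist_eq, ← sub_mul, abs_mul, abs_of_pos (Real.exp_pos _)]
    simp only [Real.coe_nnabs, abs_abs]
    rw [abs_mul, abs_of_pos (Real.exp_pos _)]
    have h1 := abs_abs_sub_abs_le_abs_sub (x * z - a) (y * z - a)
    rw [show x * z - a - (y * z - a) = z * (x - y) by ring, abs_mul] at h1
    nlinarith [Real.exp_pos (-(1/2) * z ^ 2)]
  · have : ∀ᵐ z : ℝ, z ≠ a / σ := by simp [ae_iff]
    filter_upwards [this] with z hz
    have hne : σ * z - a ≠ 0 := by
      intro h; apply hz; field_simp; linarith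
    have hd : HasDerivAt (fun s : ℝ => s * z - a) z σ := by
      simpa using ((hasDerivAt_id σ).mul_const z).sub_const a
    rcases lt_or_gt_of_ne hz with hlt | hgt
    · have hneg : σ * z - a < 0 := by
        rw [lt_div_iff₀ hσ] at hlt; linarith
      have := ((hasDerivAt_abs_neg hneg).comp σ hd).mul_const (Real.exp (-(1/2) * z ^ 2))
      refine this.congr_deriv ?_
      simp only [hF']
      rw [Set.indicator_of_notMem (by simpa using hlt.le)]
      ring
    · have hpos : 0 < σ * z - a := by
        rw [div_lt_iff₀ hσ] at hgt; linarith
      have := ((hasDerivAt_abs_pos hpos).comp σ hd).mul_const (Real.exp (-(1/2) * z ^ 2))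
      refine this.congr_deriv ?_
      simp only [hF']
      rw [Set.indicator_of_mem (by simpa using hgt)]
      ring

lemma dens_eq (R x s : ℝ) (hR : R ∈ Set.Ioo (-1 : ℝ) 1) :
    biGaussDensity R x (s - x) = (1 / (2 * Real.pi * Real.sqrt (1 - R ^ 2))) *
      (Real.exp (-(1/(4*(1+R))) * s ^ 2) * Real.exp (-(1/(1-R)) * (x - s/2)^2)) := by
  unfold biGaussDensity
  rw [← Real.exp_add]
  congr 2
  have h1 : 1 + R ≠ 0 := by linarith [hR.1]
  have h2 : 1 - R ≠ 0 := by linarith [hR.2]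
  rw [show 1 - R^2 = (1+R)*(1-R) by ring]
  field_simp
  ring

lemma gauss_shift (b m : ℝ) : ∫ x : ℝ, Real.exp (-b * (x - m)^2) = √(π / b) := by
  rw [integral_sub_right_eq_self (fun x : ℝ => Real.exp (-b * x ^ 2)) m, integral_gaussian]

lemma prod_int (R a : ℝ) (hR : R ∈ Set.Ioo (-1 : ℝ) 1) :
    Integrable (fun p : ℝ × ℝ => |p.2 - a| * biGaussDensity R p.1 (p.2 - p.1))
      (volume.prod volume) := by
  have h1 : 0 < 1 + R := by linarith [hR.1]
  have h2 : 0 < 1 - R := by linarith [hR.2]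
  have hm : Continuous (fun p : ℝ × ℝ => |p.2 - a| * biGaussDensity R p.1 (p.2 - p.1)) := by
    unfold biGaussDensity
    fun_prop
  rw [integrable_prod_iff' hm.aestronglyMeasurable]
  have hx : ∀ s : ℝ, Integrable (fun x : ℝ => Real.exp (-(1/(1-R)) * (x - s/2)^2)) := fun s =>
    (integrable_exp_neg_mul_sq (b := 1/(1-R)) (by positivity)).comp_sub_right (s/2)
  constructor
  · refine Filter.Eventually.of_forall fun s => ?_
    simp only [dens_eq R _ _ hR]
    exact (((hx s).const_mul _).const_mul _).const_mul _
  · have : ∀ s x : ℝ, ‖|s - a| * biGaussDensity R x (s - x)‖ =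
       ((1 / (2 * Real.pi * Real.sqrt (1 - R ^ 2))) * (|1 * s - a| * Real.exp (-(1/(4*(1+R))) * s ^ 2)))
         * Real.exp (-(1/(1-R)) * (x - s/2)^2) := by
      intro s x
      rw [dens_eq R _ _ hR, Real.norm_of_nonneg (by positivity)]
      ring_nf
    simp only [this, integral_const_mul, gauss_shift]
    exact ((aux_int a 1 (1/(4*(1+R))) (by positivity)).const_mul _).mul_const _

lemma prod_int' (R a : ℝ) (hR : R ∈ Set.Ioo (-1 : ℝ) 1) :
    Integrable (fun p : ℝ × ℝ => |p.1 + p.2 - a| * biGaussDensity R p.1 p.2)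
      (volume.prod volume) := by
  have := (measurePreserving_prod_add (volume : Measure ℝ) (volume : Measure ℝ)).integrable_comp_of_integrable
    (prod_int R a hR)
  refine this.congr (Filter.Eventually.of_forall fun p => ?_)
  simp

lemma dens_neg (R x y : ℝ) : biGaussDensity R x (-y) = biGaussDensity (-R) x y := by
  unfold biGaussDensity
  congr 2
  · ring_nf
  · ring_nf

lemma prod_int'' (R a : ℝ) (hR : R ∈ Set.Ioo (-1 : ℝ) 1) :
    Integrable (fun p : ℝ × ℝ => |p.1 - p.2 - a| * biGaussDensity R p.1 p.2)
      (volume.prod volume) := by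
  have := ((MeasurePreserving.id (volume : Measure ℝ)).prod
    (Measure.measurePreserving_neg (volume : Measure ℝ))).integrable_comp_of_integrable
    (prod_int' (-R) a ⟨by linarith [hR.2], by linarith [hR.1]⟩)
  refine this.congr (Filter.Eventually.of_forall fun p => ?_)
  simp [← dens_neg, sub_eq_add_neg]

lemma val (R a : ℝ) (hR : R ∈ Set.Ioo (-1 : ℝ) 1) :
    ∫ x : ℝ, ∫ y : ℝ, |x + y - a| * biGaussDensity R x y =
      (1 / √(2 * π)) * auxB a √(2 * (1 + R)) := by
  have h1 : 0 < 1 + R := by linarith [hR.1]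
  have h2 : 0 < 1 - R := by linarith [hR.2]
  have hs : ∀ x : ℝ, ∫ y : ℝ, |x + y - a| * biGaussDensity R x y =
      ∫ s : ℝ, |s - a| * biGaussDensity R x (s - x) := by
    intro x
    rw [← integral_add_left_eq_self (fun s => |s - a| * biGaussDensity R x (s - x)) x]
    simp
  simp only [hs]
  rw [integral_integral_swap (prod_int R a hR)]
  simp only [dens_eq R _ _ hR, integral_const_mul, gauss_shift]
  have hσ : 0 < √(2 * (1 + R)) := by positivity
  have hsc := Measure.integral_comp_mul_left
    (fun s : ℝ => |s - a| * Real.exp (-(1/(4*(1+R))) * s ^ 2)) √(2 * (1 + R))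
  have hB : auxB a √(2 * (1 + R)) = ∫ x : ℝ, |√(2 * (1 + R)) * x - a| *
      Real.exp (-(1/(4*(1+R))) * (√(2 * (1 + R)) * x) ^ 2) := by
    unfold auxB
    congr 1; ext x
    rw [mul_pow, Real.sq_sqrt (by positivity)]
    congr 2
    field_simp
    ring
  rw [hB, hsc, abs_of_pos (by positivity), smul_eq_mul, ← integral_const_mul, ← integral_const_mul]
  congr 1; ext s
  rw [show 1 - R^2 = (1+R)*(1-R) by ring, Real.sqrt_mul h1.le, show π / (1/(1-R)) = π * (1-R) by field_simp,
    Real.sqrt_mul pi_pos.le, Real.sqrt_mul zero_le_two, Real.sqrt_mul zero_le_two]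
  have e1 := Real.sq_sqrt pi_pos.le
  have e2 := Real.sq_sqrt (zero_le_two (α := ℝ))
  have p1 : 0 < √(1+R) := by positivity
  have p2 : 0 < √(1-R) := by positivity
  have p3 : 0 < √π := by positivity
  have p4 : 0 < √2 := by positivity
  field_simp
  rw [e1, e2]
  try ring

lemma val' (R a : ℝ) (hR : R ∈ Set.Ioo (-1 : ℝ) 1) :
    ∫ x : ℝ, ∫ y : ℝ, |x - y - a| * biGaussDensity R x y =
      (1 / √(2 * π)) * auxB a √(2 * (1 - R)) := by
  have := val (-R) a ⟨by linarith [hR.2], by linarith [hR.1]⟩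
  rw [← sub_eq_add_neg] at this
  rw [← this]
  congr 1; ext x
  rw [← integral_neg_eq_self]
  simp [dens_neg]

lemma auxB_ftc (a ρ : ℝ) (hρ : ρ ∈ Set.Ioo (-1 : ℝ) 1) :
    HasDerivAt (fun ρ => (1 / √(2 * π)) * auxB a √(2 * (1 + ρ)))
      (1 / √(π * (1 + ρ)) * Real.exp (-a ^ 2 / (4 * (1 + ρ)))) ρ := by
  have h1 : 0 < 1 + ρ := by linarith [hρ.1]
  have hσ : 0 < √(2 * (1 + ρ)) := by positivity
  have hi : HasDerivAt (fun ρ : ℝ => 2 * (1 + ρ)) 2 ρ := by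
    simpa using ((hasDerivAt_id ρ).const_add 1).const_mul 2
  have := ((auxB_deriv a _ hσ).comp ρ (hi.sqrt (by positivity))).const_mul (1 / √(2 * π))
  refine this.congr_deriv ?_
  rw [div_pow, Real.sq_sqrt (by positivity)]
  rw [show -(1/2) * (a ^ 2 / (2 * (1 + ρ))) = -a ^ 2 / (4 * (1 + ρ)) by field_simp; ring]
  rw [Real.sqrt_mul pi_pos.le, Real.sqrt_mul zero_le_two, Real.sqrt_mul zero_le_two]
  have e2 := Real.sq_sqrt (zero_le_two (α := ℝ))
  have p1 : 0 < √(1+ρ) := by positivity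
  field_simp
  try rw [e2]

theorem expected_output_mixture_piecewise_linear_correlator
    (R : ℝ) (hR : R ∈ Set.Ioo (-1 : ℝ) 1)
    (L : ℕ) (w α : Fin L → ℝ)
    (hw : ∀ l, 0 ≤ w l) (hws : ∑ l, w l = 1) (hα : ∀ l, 0 ≤ α l)
    (h : ℝ → ℝ) (hh : ∀ x, h x = (1 / 2) * ∑ l, w l * (|x - α l| + |x + α l|))
    (f : ℝ → ℝ → ℝ) (hf : ∀ x y, f x y = h (x + y) - h (x - y)) :
    ∫ x : ℝ, ∫ y : ℝ, f x y * biGaussDensity R x y =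
      ∫ ρ in (0 : ℝ)..R, ∑ l,
        ((w l / Real.sqrt (Real.pi * (1 + ρ))) * Real.exp (-(α l) ^ 2 / (4 * (1 + ρ)))
          + (w l / Real.sqrt (Real.pi * (1 - ρ))) * Real.exp (-(α l) ^ 2 / (4 * (1 - ρ)))) := by
  have hsub : Set.uIcc 0 R ⊆ Set.Ioo (-1 : ℝ) 1 :=
    (Set.ordConnected_Ioo).uIcc_subset ⟨by norm_num, by norm_num⟩ hR
  -- the primitive
  set P : ℝ → ℝ → ℝ := fun a ρ => (1 / √(2 * π)) * auxB a √(2 * (1 + ρ)) with hP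
  set T : Fin L → ℝ → ℝ := fun l ρ => (w l / 2) *
    (P (α l) ρ + P (-α l) ρ - P (α l) (-ρ) - P (-α l) (-ρ)) with hT
  have hder : ∀ ρ ∈ Set.uIcc 0 R, HasDerivAt (fun ρ => ∑ l, T l ρ) (∑ l,
        ((w l / Real.sqrt (Real.pi * (1 + ρ))) * Real.exp (-(α l) ^ 2 / (4 * (1 + ρ)))
          + (w l / Real.sqrt (Real.pi * (1 - ρ))) * Real.exp (-(α l) ^ 2 / (4 * (1 - ρ))))) ρ := by
    intro ρ hρ
    have hρ := hsub hρ
    have hρ' : -ρ ∈ Set.Ioo (-1 : ℝ) 1 := ⟨by linarith [hρ.2], by linarith [hρ.1]⟩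
    refine HasDerivAt.fun_sum fun l _ => ?_
    have d1 := auxB_ftc (α l) ρ hρ
    have d2 := auxB_ftc (-α l) ρ hρ
    have d3 := (auxB_ftc (α l) (-ρ) hρ').comp ρ (hasDerivAt_neg ρ)
    have d4 := (auxB_ftc (-α l) (-ρ) hρ').comp ρ (hasDerivAt_neg ρ)
    refine ((((d1.add d2).sub d3).sub d4).const_mul (w l / 2)).congr_deriv ?_
    simp only [neg_sq, ← sub_eq_add_neg]
    ring
  rw [intervalIntegral.integral_eq_sub_of_hasDerivAt hder]
  · have h0 : ∑ l, T l 0 = 0 := by simp [hT]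
    rw [h0, sub_zero]
    have hfe : ∀ x y, f x y * biGaussDensity R x y = ∑ l, (w l / 2) *
        (|x + y - α l| * biGaussDensity R x y + |x + y - (-α l)| * biGaussDensity R x y
         - |x - y - α l| * biGaussDensity R x y - |x - y - (-α l)| * biGaussDensity R x y) := by
      intro x y
      rw [hf, hh, hh, ← mul_sub, ← Finset.sum_sub_distrib, Finset.mul_sum, Finset.sum_mul]
      refine Finset.sum_congr rfl fun l _ => ?_
      rw [sub_neg_eq_add, sub_neg_eq_add]
      ring
    have i1 := fun a => prod_int' R a hR
    have i2 := fun a => prod_int'' R a hR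
    have hI : ∀ l, Integrable (fun p : ℝ × ℝ => (w l / 2) *
        (|p.1 + p.2 - α l| * biGaussDensity R p.1 p.2 + |p.1 + p.2 - (-α l)| * biGaussDensity R p.1 p.2
         - |p.1 - p.2 - α l| * biGaussDensity R p.1 p.2 - |p.1 - p.2 - (-α l)| * biGaussDensity R p.1 p.2))
        (volume.prod volume) := fun l =>
      ((((i1 _).add (i1 _)).sub (i2 _)).sub (i2 _)).const_mul _
    simp only [hfe]
    rw [integral_integral (f := fun x y => ∑ l, (w l / 2) *
        (|x + y - α l| * biGaussDensity R x y + |x + y - (-α l)| * biGaussDensity R x y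
         - |x - y - α l| * biGaussDensity R x y - |x - y - (-α l)| * biGaussDensity R x y))
         (integrable_finsetSum _ fun l _ => hI l)]
    rw [integral_finsetSum _ fun l _ => hI l]
    refine Finset.sum_congr rfl fun l _ => ?_
    have v1 : ∀ a, ∫ p : ℝ × ℝ, |p.1 + p.2 - a| * biGaussDensity R p.1 p.2 ∂(volume.prod volume)
        = P a R := fun a => by
      rw [integral_prod _ (i1 a)]; exact val R a hR
    have v2 : ∀ a, ∫ p : ℝ × ℝ, |p.1 - p.2 - a| * biGaussDensity R p.1 p.2 ∂(volume.prod volume)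
        = P a (-R) := fun a => by
      rw [integral_prod _ (i2 a)]; exact val' R a hR
    rw [integral_const_mul, integral_sub (((i1 _).fun_add (i1 _)).sub' (i2 _)) (i2 _),
      integral_sub ((i1 _).fun_add (i1 _)) (i2 _), integral_add (i1 _) (i1 _), v1, v1, v2, v2]
  · refine ContinuousOn.intervalIntegrable ?_
    refine continuousOn_finsetSum _ fun l _ => ?_
    have hp : ∀ ρ ∈ Set.uIcc 0 R, 0 < 1 + ρ ∧ 0 < 1 - ρ := fun ρ hρ =>
      ⟨by linarith [(hsub hρ).1], by linarith [(hsub hρ).2]⟩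
    have q1 : ∀ ρ ∈ Set.uIcc 0 R, √(π * (1 + ρ)) ≠ 0 := fun ρ hρ =>
      (Real.sqrt_pos.2 (mul_pos pi_pos (hp ρ hρ).1)).ne'
    have q2 : ∀ ρ ∈ Set.uIcc 0 R, √(π * (1 - ρ)) ≠ 0 := fun ρ hρ =>
      (Real.sqrt_pos.2 (mul_pos pi_pos (hp ρ hρ).2)).ne'
    have q3 : ∀ ρ ∈ Set.uIcc 0 R, 4 * (1 + ρ) ≠ 0 := fun ρ hρ => by linarith [(hp ρ hρ).1]
    have q4 : ∀ ρ ∈ Set.uIcc 0 R, 4 * (1 - ρ) ≠ 0 := fun ρ hρ => by linarith [(hp ρ hρ).2]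
    fun_prop (disch := assumption)
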